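/- For the wheel graph W_5 = K_1 + C_4 of order 5, edim_f(W_5) = 5/2. -/

import Mathlib

open Finset
open scoped Classical

variable {V : Type*}

/-- Distance from a vertex to an edge: minimum distance to an endpoint. -/
noncomputable def SimpleGraph.edgeDist (G : SimpleGraph V) (e : Sym2 V) (v : V) : ℕ :=
  Sym2.lift ⟨fun a b => min (G.dist a v) (G.dist b v), fun a b => min_comm _ _⟩ e

/-- A set of vertices is an edge resolving set if every pair of distinct edges
is distinguished by some vertex of the set. -/
def SimpleGraph.IsEdgeResolvingSet (G : SimpleGraph V) (S : Set V) : Prop :=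
  ∀ e₁ ∈ G.edgeSet, ∀ e₂ ∈ G.edgeSet, e₁ ≠ e₂ →
    ∃ s ∈ S, G.edgeDist e₁ s ≠ G.edgeDist e₂ s

/-- The edge dimension: minimum cardinality of an edge resolving set. -/
noncomputable def SimpleGraph.edim (G : SimpleGraph V) [Fintype V] : ℕ :=
  sInf {n | ∃ S : Finset V, G.IsEdgeResolvingSet ↑S ∧ S.card = n}

/-- An edge resolving function: a `[0,1]`-valued weighting of the vertices such
that every pair of distinct edges is resolved by total weight at least 1. -/
def SimpleGraph.IsEdgeResolvingFunction (G : SimpleGraph V) [Fintype V] (g : V → ℝ) : Prop :=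
  (∀ v, 0 ≤ g v ∧ g v ≤ 1) ∧
  ∀ e₁ ∈ G.edgeSet, ∀ e₂ ∈ G.edgeSet, e₁ ≠ e₂ →
    1 ≤ ∑ z ∈ Finset.univ.filter (fun z => G.edgeDist e₁ z ≠ G.edgeDist e₂ z), g z

/-- The fractional edge dimension. -/
noncomputable def SimpleGraph.edimf (G : SimpleGraph V) [Fintype V] : ℝ :=
  sInf {x | ∃ g : V → ℝ, G.IsEdgeResolvingFunction g ∧ ∑ v, g v = x}

/-- The wheel graph `W_{m+1} = K₁ + C_m`: hub `none` adjacent to every rim vertex,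
rim vertices forming the cycle `some i ~ some (i+1)`. -/
def wheelGraph (m : ℕ) : SimpleGraph (Option (Fin m)) :=
  SimpleGraph.fromRel (fun a b =>
    match a, b with
    | none, some _ => True
    | some i, some j => (j : ℕ) = ((i : ℕ) + 1) % m
    | _, _ => False)

theorem wheelGraph_four_adj (a b : Option (Fin 4)) :
    (wheelGraph 4).Adj a b ↔ b ≠ a ∧ b ≠ a.map (· + 2) := by
  rcases a with _ | a <;> rcases b with _ | b
  · simp [wheelGraph]
  · simp [wheelGraph]
  · simp [wheelGraph]
  · fin_cases a <;> fin_cases b <;> simp [wheelGraph]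

/-- Every edge of `W₅` is a dominating set. -/
theorem wheelGraph_four_adj_or_adj {a b z : Option (Fin 4)} (hab : (wheelGraph 4).Adj a b)
    (ha : z ≠ a) (hb : z ≠ b) : (wheelGraph 4).Adj a z ∨ (wheelGraph 4).Adj b z := by
  simp only [wheelGraph_four_adj] at hab ⊢
  revert a b z
  decide

theorem wheelGraph_four_edgeDist {e : Sym2 (Option (Fin 4))} (he : e ∈ (wheelGraph 4).edgeSet)
    (z : Option (Fin 4)) : (wheelGraph 4).edgeDist e z = if z ∈ e then 0 else 1 := by
  induction e using Sym2.ind with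
  | _ a b =>
    rw [SimpleGraph.mem_edgeSet] at he
    simp only [SimpleGraph.edgeDist, Sym2.lift_mk, Sym2.mem_iff]
    by_cases ha : z = a
    · simp [ha]
    by_cases hb : z = b
    · simp [hb]
    have reach : (wheelGraph 4).Reachable a z ∧ (wheelGraph 4).Reachable b z := by
      rcases wheelGraph_four_adj_or_adj he ha hb with h | h
      · exact ⟨h.reachable, he.symm.reachable.trans h.reachable⟩
      · exact ⟨he.reachable.trans h.reachable, h.reachable⟩
    have hda := reach.1.pos_dist_of_ne (Ne.symm ha)
    have hdb := reach.2.pos_dist_of_ne (Ne.symm hb)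
    rw [if_neg (by tauto)]
    rcases wheelGraph_four_adj_or_adj he ha hb with h | h <;>
      have := SimpleGraph.dist_eq_one_iff_adj.2 h <;> omega

theorem wheelGraph_four_edgeDist_ne_iff {e₁ e₂ : Sym2 (Option (Fin 4))}
    (h₁ : e₁ ∈ (wheelGraph 4).edgeSet) (h₂ : e₂ ∈ (wheelGraph 4).edgeSet) (z : Option (Fin 4)) :
    (wheelGraph 4).edgeDist e₁ z ≠ (wheelGraph 4).edgeDist e₂ z ↔ ¬(z ∈ e₁ ↔ z ∈ e₂) := by
  rw [wheelGraph_four_edgeDist h₁, wheelGraph_four_edgeDist h₂]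
  by_cases hz₁ : z ∈ e₁ <;> by_cases hz₂ : z ∈ e₂ <;> simp [hz₁, hz₂]

theorem Sym2.exists_mem_notMem_of_not_isDiag {e₁ e₂ : Sym2 V} (h₁ : ¬e₁.IsDiag) (hne : e₁ ≠ e₂) :
    ∃ z ∈ e₁, z ∉ e₂ := by
  induction e₁ using Sym2.ind with
  | _ a b =>
    by_contra! h
    exact hne ((Sym2.mem_and_mem_iff (by simpa using h₁)).1
      ⟨h a (Sym2.mem_mk_left a b), h b (Sym2.mem_mk_right a b)⟩).symm

theorem wheelGraph_four_isEdgeResolvingFunction_half :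
    (wheelGraph 4).IsEdgeResolvingFunction (fun _ => 1 / 2) := by
  refine ⟨fun _ => by norm_num, fun e₁ h₁ e₂ h₂ hne => ?_⟩
  obtain ⟨z, hz₁, hz₂⟩ := Sym2.exists_mem_notMem_of_not_isDiag
    ((wheelGraph 4).not_isDiag_of_mem_edgeSet h₁) hne
  obtain ⟨w, hw₂, hw₁⟩ := Sym2.exists_mem_notMem_of_not_isDiag
    ((wheelGraph 4).not_isDiag_of_mem_edgeSet h₂) hne.symm
  have hzw : z ≠ w := fun h => hw₁ (h ▸ hz₁)
  calc (1 : ℝ) = ∑ _x ∈ {z, w}, (1 / 2 : ℝ) := by rw [Finset.sum_pair hzw]; norm_num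
    _ ≤ _ := by
      refine Finset.sum_le_sum_of_subset_of_nonneg ?_ fun _ _ _ => by norm_num
      intro x hx
      simp only [Finset.mem_insert, Finset.mem_singleton] at hx
      rw [Finset.mem_filter, wheelGraph_four_edgeDist_ne_iff h₁ h₂]
      rcases hx with rfl | rfl <;> simp [*]

/-- Two edges sharing an endpoint are resolved exactly by their other endpoints. -/
theorem one_le_add_of_wheelGraph_four_adj {g : Option (Fin 4) → ℝ}
    (hg : (wheelGraph 4).IsEdgeResolvingFunction g) {a b c : Option (Fin 4)}
    (hb : (wheelGraph 4).Adj a b) (hc : (wheelGraph 4).Adj a c) (hbc : b ≠ c) :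
    1 ≤ g b + g c := by
  have h := hg.2 s(a, b) hb s(a, c) hc (Sym2.congr_right.not.2 hbc)
  rw [← Finset.sum_pair hbc]
  convert h using 2
  ext z
  rw [Finset.mem_filter, wheelGraph_four_edgeDist_ne_iff hb hc]
  have hab := hb.ne
  have hac := hc.ne
  simp only [Finset.mem_insert, Finset.mem_singleton, Finset.mem_univ, true_and, Sym2.mem_iff]
  grind

/-- For the wheel graph `W₅ = K₁ + C₄`, `edim_f(W₅) = 5/2`. -/
theorem stmt_15 : (wheelGraph 4).edimf = 5 / 2 := by
  refine IsLeast.csInf_eq ⟨⟨_, wheelGraph_four_isEdgeResolvingFunction_half, by norm_num⟩, ?_⟩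
  rintro x ⟨g, hg, rfl⟩
  have pair {b c : Option (Fin 4)} (a : Option (Fin 4))
      (h : (b ≠ a ∧ b ≠ a.map (· + 2)) ∧ (c ≠ a ∧ c ≠ a.map (· + 2)) ∧ b ≠ c) :
      1 ≤ g b + g c :=
    one_le_add_of_wheelGraph_four_adj hg ((wheelGraph_four_adj a b).2 h.1)
      ((wheelGraph_four_adj a c).2 h.2.1) h.2.2
  have h₀ : 1 ≤ g none + g (some 0) := pair (some 1) (by decide)
  have h₁ : 1 ≤ g (some 0) + g (some 1) := pair none (by decide)
  have h₂ : 1 ≤ g (some 1) + g (some 2) := pair none (by decide)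
  have h₃ : 1 ≤ g (some 2) + g (some 3) := pair none (by decide)
  have h₄ : 1 ≤ g (some 3) + g none := pair (some 0) (by decide)
  rw [Fintype.sum_option, Fin.sum_univ_four]
  linarith
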